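/- Suppose every utility function u_i is continuous, semi-strictly quasi-concave, and strictly increasing. Then for every ε > 0 there exist α ∈ (0,1] and an α-slack equilibrium (x*, p*) such that x* is 𝒞-constrained Pareto efficient and, for every agent i and every y ∈ X_i with p*_i · y ≤ p*_i · ω_i, one has u_i(y) − u_i(x*_i) < ε. In particular, u_i(x*_i) > u_i(ω_i) − ε for every i (ε-individual rationality). -/

import Mathlib

open Finset

noncomputable def dotO {O : Type*} [Fintype O] (p z : O → ℝ) : ℝ := ∑ l, p l * z l

noncomputable def dotIO {I O : Type*} [Fintype I] [Fintype O] (a x : I → O → ℝ) : ℝ :=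
  ∑ i, ∑ l, a i l * x i l

noncomputable def pers {I O C : Type*} [Fintype C] (a : C → I → O → ℝ) (p : C → ℝ)
    (i : I) : O → ℝ :=
  fun l => ∑ c, a c i l * p c

section Scarf

variable {V I : Type*}

/-- A set `S` is dominant for the rankings `R i` if every `y` is weakly below all of `S` in at
least one of the rankings. -/
def Dominant (R : I → V → ℕ) (S : Finset V) : Prop :=
  ∀ y, ∃ i, ∀ x ∈ S, R i y ≤ R i x

instance [Fintype V] [Fintype I] (R : I → V → ℕ) : DecidablePred (Dominant R) := fun _ => by
  unfold Dominant
  infer_instance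

theorem Dominant.mono {R : I → V → ℕ} {S T : Finset V} (hT : Dominant R T) (h : S ⊆ T) :
    Dominant R S := fun y => (hT y).imp fun _ hi x hx => hi x (h hx)

variable [DecidableEq V] [Fintype I] [DecidableEq I]

theorem even_card_erase_image_eq (c : V → I) (k : I) {S : Finset V}
    (hcard : S.card = Fintype.card I) (hne : S.image c ≠ univ) :
    Even #{x ∈ S | (S.erase x).image c = univ.erase k} := by
  by_cases h : ∃ x ∈ S, (S.erase x).image c = univ.erase k
  · obtain ⟨x, hx, hxc⟩ := h
    have hmem : ∀ m, m ≠ k → ∃ w ∈ S, w ≠ x ∧ c w = m := by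
      intro m hm
      have : m ∈ (S.erase x).image c := by rw [hxc]; simp [hm]
      obtain ⟨w, hw, hwm⟩ := mem_image.1 this
      exact ⟨w, (mem_erase.1 hw).2, (mem_erase.1 hw).1, hwm⟩
    have hnk : ∀ w ∈ S, w ≠ x → c w ≠ k := by
      intro w hw hwx
      have : c w ∈ (S.erase x).image c := mem_image_of_mem _ (by simp [hw, hwx])
      rw [hxc] at this
      simpa using this
    have hcx : c x ≠ k := by
      intro hcx
      apply hne
      ext m
      simp only [mem_image, mem_univ, iff_true]
      by_cases hm : m = k
      · exact ⟨x, hx, by rw [hcx, hm]⟩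
      · obtain ⟨w, hw, -, hwm⟩ := hmem m hm
        exact ⟨w, hw, hwm⟩
    obtain ⟨x', hx', hxx', hcx'⟩ := hmem _ hcx
    have hinj : Set.InjOn c (S.erase x : Finset V) := by
      rw [← card_image_iff, hxc, card_erase_of_mem (mem_univ _), card_erase_of_mem hx, hcard,
        card_univ]
    have hset : ({y ∈ S | (S.erase y).image c = univ.erase k} : Finset V) = {x, x'} := by
      ext y
      simp only [mem_filter, mem_insert, mem_singleton]
      constructor
      · rintro ⟨hy, hyc⟩
        by_contra! hcon
        have : c y ∈ (S.erase y).image c := by rw [hyc]; simp [hnk y hy hcon.1]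
        obtain ⟨z, hz, hzy⟩ := mem_image.1 this
        rw [mem_erase] at hz
        by_cases hzx : z = x
        · subst hzx
          exact hcon.2 (hinj (by simp [hy, hcon.1]) (by simp [hx', hxx']) (by rw [hcx', hzy]))
        · exact hz.1 (hinj (by simp [hz.2, hzx]) (by simp [hy, hcon.1]) hzy)
      · rintro (rfl | rfl)
        · exact ⟨hx, hxc⟩
        · refine ⟨hx', ?_⟩
          ext m
          simp only [mem_image, mem_erase, mem_univ, and_true]
          constructor
          · rintro ⟨w, ⟨-, hw⟩, rfl⟩
            by_cases hwx : w = x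
            · rwa [hwx]
            · exact hnk w hw hwx
          · intro hm
            obtain ⟨w, hw, hwx, hwm⟩ := hmem m hm
            by_cases hwx' : w = y
            · exact ⟨x, ⟨hxx'.symm, hx⟩, by rw [← hcx', ← hwx', hwm]⟩
            · exact ⟨w, ⟨hwx', hw⟩, hwm⟩
    rw [hset, card_pair hxx'.symm]
    exact even_two
  · push Not at h
    rw [filter_false_of_mem h]
    simp

variable [Fintype V] {R : I → V → ℕ} {s : I → V}

theorem card_dominant_insert_eq_two (hR : ∀ i, Function.Injective (R i))
    (hmax : ∀ i j, i ≠ j → ∀ v ∉ Set.range s, R i v < R i (s j))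
    {S : Finset V} (hS : Dominant R S) (hcard : S.card + 1 = Fintype.card I)
    {t : V} (htS : t ∈ S) (ht : t ∉ Set.range s) :
    #{x | x ∉ S ∧ Dominant R (insert x S)} = 2 := by
  have hmin : ∀ i, ∃ m ∈ S, ∀ x ∈ S, R i m ≤ R i x := fun i => exists_min_image S (R i) ⟨t, htS⟩
  choose μ hμS hμ using hmin
  have hμeq : ∀ i, ∀ z ∈ S, (∀ x ∈ S, R i z ≤ R i x) → μ i = z := fun i z hz h =>
    hR i (le_antisymm (hμ i z hz) (h _ (hμS i)))
  obtain ⟨i, -, j, -, hij, hμij⟩ := exists_ne_map_eq_of_card_lt_of_maps_to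
    (s := univ) (t := S) (by rw [card_univ]; omega) (fun a _ => hμS a)
  let M : I → V → Prop := fun a x => ∀ k, k ≠ a → R k (μ k) < R k x
  have hMne : ∀ a, ∃ x, M a x ∧ ∀ y, M a y → R a y ≤ R a x := by
    intro a
    classical
    obtain ⟨x, hx, hx'⟩ := exists_max_image ({x | M a x} : Finset V) (R a)
      ⟨s a, by simpa using fun k hk => (hμ k t htS).trans_lt (hmax k a hk t ht)⟩
    exact ⟨x, by simpa using hx, fun y hy => hx' y (by simpa using hy)⟩
  choose w hwM hw using hMne
  have hback : ∀ a b, a ≠ b → μ a = μ b → w a ∉ S ∧ Dominant R (insert (w a) S) := by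
    intro a b hab hμab
    refine ⟨fun hmem => ?_, fun y => ?_⟩
    · obtain ⟨k, hk⟩ := hS (w a)
      have hk' := hμeq k _ hmem hk
      by_cases hka : k = a
      · subst hka
        have := hwM k b hab.symm
        rw [← hμab, hk'] at this
        exact this.false
      · have := hwM a k hka
        rw [hk'] at this
        exact this.false
    · by_cases hy : M a y
      · obtain ⟨k, hk⟩ := hS y
        have hka : k = a := by
          by_contra hka
          exact (hy k hka).not_ge (hk _ (hμS k))
        subst hka
        refine ⟨k, fun x hx => ?_⟩
        rcases mem_insert.1 hx with rfl | hx
        · exact hw k y hy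
        · exact hk x hx
      · simp only [M] at hy
        push Not at hy
        obtain ⟨k, hka, hk⟩ := hy
        refine ⟨k, fun x hx => ?_⟩
        rcases mem_insert.1 hx with rfl | hx
        · exact hk.trans (hwM a k hka).le
        · exact hk.trans (hμ k x hx)
  have hwij : w i ≠ w j := by
    intro h
    have h1 := hwM i j hij.symm
    have h2 : M i (w j) := h ▸ hwM i
    have h3 := hwM j
    obtain ⟨k, hk⟩ := hS (w j)
    have hk' := hk _ (hμS k)
    by_cases hki : k = i
    · exact (h3 k (hki ▸ hij)).not_ge hk'
    · exact (h2 k hki).not_ge hk'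
  have hset : ({x | x ∉ S ∧ Dominant R (insert x S)} : Finset V) = {w i, w j} := by
    ext x
    simp only [mem_filter, mem_univ, true_and, mem_insert, mem_singleton]
    constructor
    · rintro ⟨hxS, hdom⟩
      obtain ⟨a, ha⟩ := hdom x
      let K : Finset I := {k | R k (μ k) < R k x}
      have hKsub : K ⊆ univ.erase a := by
        intro k hk
        simp only [K, mem_filter, mem_univ, true_and] at hk
        rw [mem_erase]
        refine ⟨?_, mem_univ _⟩
        rintro rfl
        exact hk.not_ge (ha _ (mem_insert_of_mem (hμS k)))
      have hSK : S ⊆ K.image μ := by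
        intro z hz
        obtain ⟨k, hk⟩ := hdom z
        have hkz := hμeq k z hz fun y hy => hk y (mem_insert_of_mem hy)
        refine mem_image.2 ⟨k, ?_, hkz⟩
        simp only [K, mem_filter, mem_univ, true_and]
        rw [hkz]
        refine lt_of_le_of_ne (hk x (mem_insert_self _ _)) fun h => hxS ?_
        rwa [← hR k h]
      have hc1 := card_le_card hSK
      have hc2 : (K.image μ).card ≤ K.card := card_image_le
      have hc3 : (univ.erase a).card = S.card := by
        rw [card_erase_of_mem (mem_univ _), card_univ]; omega
      have hK : K = univ.erase a := eq_of_subset_of_card_le hKsub (by omega)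
      have hinj : Set.InjOn μ K := card_image_iff.1 (by rw [← hK] at hc3; omega)
      have hMx : M a x := by
        intro k hk
        have : k ∈ K := by rw [hK]; simp [hk]
        simpa [K] using this
      have hxa : x = w a := by
        refine hR a (le_antisymm (hw a x hMx) ?_)
        obtain ⟨k, hk⟩ := hdom (w a)
        by_cases hka : k = a
        · subst hka
          exact hk x (mem_insert_self _ _)
        · exact absurd (hk _ (mem_insert_of_mem (hμS k))) (hwM a k hka).not_ge
      by_cases hai : a = i
      · left; rw [hxa, hai]
      by_cases haj : a = j
      · right; rw [hxa, haj]
      refine absurd (hinj ?_ ?_ hμij) hij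
      · rw [hK]; simp [Ne.symm hai]
      · rw [hK]; simp [Ne.symm haj]
    · rintro (rfl | rfl)
      · exact hback i j hij hμij
      · exact hback j i hij.symm hμij.symm
  rw [hset, card_pair hwij]

theorem card_dominant_insert_slacks (hR : ∀ i, Function.Injective (R i))
    (hmin : ∀ i v, R i (s i) ≤ R i v)
    (hmax : ∀ i j, i ≠ j → ∀ v ∉ Set.range s, R i v < R i (s j))
    {t : V} (ht : t ∉ Set.range s) (k : I) :
    #{x | x ∉ (univ.erase k).image s ∧ Dominant R (insert x ((univ.erase k).image s))} = 1 := by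
  have hlt : ∀ i, ∀ v ∉ Set.range s, R i (s i) < R i v := fun i v hv =>
    lt_of_le_of_ne (hmin i v) fun h => hv ⟨i, hR i h⟩
  classical
  obtain ⟨x₀, hx₀, hx₀max⟩ := exists_max_image ({x | x ∉ Set.range s} : Finset V) (R k)
    ⟨t, by simpa using ht⟩
  replace hx₀ : x₀ ∉ Set.range s := by simpa using hx₀
  replace hx₀max : ∀ y ∉ Set.range s, R k y ≤ R k x₀ := fun y hy => hx₀max y (by simpa using hy)
  rw [card_eq_one]
  refine ⟨x₀, ?_⟩
  ext x
  simp only [mem_filter, mem_univ, true_and, mem_singleton]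
  have hmemS : ∀ i, i ≠ k → s i ∈ (univ.erase k).image s := fun i hi =>
    mem_image_of_mem _ (by simp [hi])
  constructor
  · rintro ⟨hxS, hdom⟩
    have key : ∀ y ∉ Set.range s, R k y ≤ R k x := by
      intro y hy
      obtain ⟨i, hi⟩ := hdom y
      by_cases hik : i = k
      · subst hik
        exact hi x (mem_insert_self _ _)
      · exact absurd (hi _ (mem_insert_of_mem (hmemS i hik))) (hlt i y hy).not_ge
    have hx : x ∉ Set.range s := by
      rintro ⟨i, rfl⟩
      by_cases hik : i = k
      · subst hik
        exact (hlt i t ht).not_ge (key t ht)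
      · exact hxS (hmemS i hik)
    exact hR k (le_antisymm (hx₀max x hx) (key x₀ hx₀))
  · rintro rfl
    refine ⟨fun h => ?_, fun y => ?_⟩
    · obtain ⟨i, -, hi⟩ := mem_image.1 h
      exact hx₀ ⟨i, hi⟩
    · by_cases hy : y ∈ Set.range s
      · obtain ⟨i, rfl⟩ := hy
        exact ⟨i, fun z _ => hmin i z⟩
      · refine ⟨k, fun z hz => ?_⟩
        rcases mem_insert.1 hz with rfl | hz
        · exact hx₀max y hy
        · obtain ⟨m, hm, rfl⟩ := mem_image.1 hz
          exact (hmax k m (mem_erase.1 hm).1.symm y hy).le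

/-- **Scarf's lemma** on fully coloured dominant sets, with `s i` the slack element of colour `i`. -/
theorem exists_dominant_image_eq_univ [Nonempty I] (hR : ∀ i, Function.Injective (R i))
    (hmin : ∀ i v, R i (s i) ≤ R i v)
    (hmax : ∀ i j, i ≠ j → ∀ v ∉ Set.range s, R i v < R i (s j))
    {t : V} (ht : t ∉ Set.range s) (c : V → I) (hc : ∀ i, c (s i) = i) :
    ∃ S : Finset V, Dominant R S ∧ S.image c = univ := by
  by_contra! hcon
  obtain ⟨k⟩ := ‹Nonempty I›
  have hn : 0 < Fintype.card I := Fintype.card_pos_iff.2 ⟨k⟩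
  let doors : Finset (Finset V) :=
    {D | D.card + 1 = Fintype.card I ∧ Dominant R D ∧ D.image c = univ.erase k}
  let rooms : Finset (Finset V) := {S | S.card = Fintype.card I ∧ Dominant R S}
  have hcount : ∑ D ∈ doors, #{x | x ∉ D ∧ Dominant R (insert x D)} =
      ∑ S ∈ rooms, #{x ∈ S | (S.erase x).image c = univ.erase k} := by
    rw [← card_sigma, ← card_sigma]
    refine card_bij' (fun q _ => ⟨insert q.2 q.1, q.2⟩) (fun q _ => ⟨q.1.erase q.2, q.2⟩)
      ?_ ?_ ?_ ?_
    · rintro ⟨D, x⟩ hq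
      simp only [doors, rooms, mem_sigma, mem_filter, mem_univ, true_and] at hq ⊢
      obtain ⟨⟨h1, h2, h3⟩, h4, h5⟩ := hq
      exact ⟨⟨by rw [card_insert_of_notMem h4, h1], h5⟩, mem_insert_self _ _, by
        rw [erase_insert h4, h3]⟩
    · rintro ⟨S, x⟩ hq
      simp only [doors, rooms, mem_sigma, mem_filter, mem_univ, true_and] at hq ⊢
      obtain ⟨⟨h1, h2⟩, h3, h4⟩ := hq
      refine ⟨⟨by rw [card_erase_of_mem h3]; omega, h2.mono (erase_subset _ _), h4⟩,
        by simp, ?_⟩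
      rwa [insert_erase h3]
    · rintro ⟨D, x⟩ hq
      simp only [mem_sigma, mem_filter, mem_univ, true_and] at hq
      simp [erase_insert hq.2.1]
    · rintro ⟨S, x⟩ hq
      simp only [mem_sigma, mem_filter] at hq
      simp [insert_erase hq.2.1]
  have heven : Even (∑ S ∈ rooms, #{x ∈ S | (S.erase x).image c = univ.erase k}) := by
    refine even_sum _ fun S hS => ?_
    simp only [rooms, mem_filter, mem_univ, true_and] at hS
    exact even_card_erase_image_eq c k hS.1 (hcon S hS.2)
  have hsinj : Function.Injective s := Function.LeftInverse.injective hc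
  have hslack := card_dominant_insert_slacks hR hmin hmax ht k
  have hD₀ : (univ.erase k).image s ∈ doors := by
    simp only [doors, mem_filter, mem_univ, true_and]
    refine ⟨?_, ?_, ?_⟩
    · rw [card_image_of_injective _ hsinj, card_erase_of_mem (mem_univ _), card_univ]; omega
    · obtain ⟨x, hx⟩ := card_pos.1 (by rw [hslack]; exact one_pos)
      exact (mem_filter.1 hx).2.2.mono (subset_insert _ _)
    · rw [image_image, show c ∘ s = id from funext hc, image_id]
  have hodd : Odd (∑ D ∈ doors, #{x | x ∉ D ∧ Dominant R (insert x D)}) := by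
    rw [← add_sum_erase _ _ hD₀, hslack]
    refine odd_one.add_even (even_sum _ fun D hD => ?_)
    simp only [doors, mem_erase, mem_filter, mem_univ, true_and] at hD
    obtain ⟨hne, h1, h2, h3⟩ := hD
    by_cases h : ∃ t ∈ D, t ∉ Set.range s
    · obtain ⟨t, htD, ht⟩ := h
      rw [card_dominant_insert_eq_two hR hmax h2 h1 htD ht]
      exact even_two
    · push Not at h
      refine absurd ?_ hne
      rw [← h3, image_image, ← image_id (s := D), image_image]
      refine image_congr fun v hv => ?_
      obtain ⟨i, rfl⟩ := h v hv
      simp [hc]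
  rw [hcount] at hodd
  exact Nat.not_even_iff_odd.2 hodd heven

end Scarf

section Brouwer

variable {I : Type*} [Fintype I]

theorem exists_mem_stdSimplex_close_colours [Nonempty I] (c : (I → ℝ) → I) {δ : ℝ} (hδ : 0 < δ) :
    ∃ p ∈ stdSimplex ℝ I, ∀ i, p i ≤ δ ∨ ∃ q ∈ stdSimplex ℝ I, dist q p ≤ δ ∧ c q = i := by
  classical
  obtain ⟨l, hl⟩ := exists_nat_gt ((Fintype.card I : ℝ) / δ)
  have hlpos : (0 : ℝ) < l := (by positivity : (0 : ℝ) ≤ Fintype.card I / δ).trans_lt hl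
  have hnl : (Fintype.card I : ℝ) / l ≤ δ := by
    rw [div_lt_iff₀ hδ] at hl
    rw [div_le_iff₀ hlpos]
    linarith
  let T := {x : I → ℕ // x ∈ piAntidiag univ l}
  have hT : ∀ x : T, ∑ i, x.1 i = l := fun x => (mem_piAntidiag.1 x.2).1
  let V := T ⊕ I
  let _ : Fintype V := inferInstanceAs
    (Fintype ({x : I → ℕ // x ∈ piAntidiag univ l} ⊕ I))
  let pt : V → I → ℕ := Sum.elim (fun x i => x.1 i + 1) (fun j i => if i = j then 0 else l + 2)
  let e : V ≃ Fin (Fintype.card V) := Fintype.equivFin V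
  let R : I → V → ℕ := fun i v => pt v i * Fintype.card V + e v
  have hRlt : ∀ i v w, pt v i < pt w i → R i v < R i w := by
    intro i v w h
    have h1 : (e v : ℕ) < Fintype.card V := (e v).2
    have h2 : (pt v i + 1) * Fintype.card V ≤ pt w i * Fintype.card V := Nat.mul_le_mul_right _ h
    simp only [R]
    linarith
  have hRle : ∀ i v w, R i v ≤ R i w → pt v i ≤ pt w i := fun i v w h => by
    by_contra! hlt
    exact (hRlt i w v hlt).not_ge h
  have hRinj : ∀ i, Function.Injective (R i) := by
    intro i v w h
    have hp : pt v i = pt w i := le_antisymm (hRle i v w h.le) (hRle i w v h.ge)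
    simp only [R, hp] at h
    exact e.injective (Fin.ext (by omega))
  have hgrid : ∀ v : V, v ∉ Set.range (Sum.inr : I → V) → ∃ x : T, v = Sum.inl x := by
    rintro (x | i) hv
    · exact ⟨x, rfl⟩
    · exact absurd ⟨i, rfl⟩ hv
  have hle : ∀ (x : T) i, x.1 i ≤ l := fun x i => by
    exact (single_le_sum (fun _ _ => Nat.zero_le _) (mem_univ i)).trans_eq (hT x)
  have hmin : ∀ i v, R i (Sum.inr i) ≤ R i v := by
    rintro i (x | j)
    · exact (hRlt _ _ _ (by simp [pt])).le
    · by_cases hij : i = j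
      · rw [hij]
      · exact (hRlt _ _ _ (by simp [pt, hij])).le
  have hmax : ∀ i j, i ≠ j → ∀ v ∉ Set.range (Sum.inr : I → V), R i v < R i (Sum.inr j) := by
    intro i j hij v hv
    obtain ⟨x, rfl⟩ := hgrid v hv
    refine hRlt _ _ _ ?_
    have := hle x i
    simp [pt, hij]
    omega
  obtain ⟨i₀⟩ := ‹Nonempty I›
  let t₀ : T := ⟨Pi.single i₀ l, by simp [mem_piAntidiag]⟩
  let sc : T → I → ℝ := fun x i => (x.1 i : ℝ) / l
  have hsc : ∀ x, sc x ∈ stdSimplex ℝ I := by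
    intro x
    refine ⟨fun i => by positivity, ?_⟩
    simp only [sc]
    rw [← sum_div, ← Nat.cast_sum, hT, div_self hlpos.ne']
  let cc : V → I := Sum.elim (fun x => c (sc x)) id
  have : Nonempty I := ⟨i₀⟩
  obtain ⟨S, hdom, himg⟩ := exists_dominant_image_eq_univ hRinj hmin hmax
    (t := Sum.inl t₀) (by simp) cc (fun i => rfl)
  have hcol : ∀ i, ∃ v ∈ S, cc v = i := fun i => by
    simpa using (himg ▸ mem_univ i : i ∈ S.image cc)
  have hSne : S.Nonempty := let ⟨v, hv, _⟩ := hcol i₀; ⟨v, hv⟩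
  have hex : ∀ i, ∃ v ∈ S, ∀ w ∈ S, pt v i ≤ pt w i := fun i =>
    exists_min_image S (fun v => pt v i) hSne
  choose μ hμS hμ using hex
  let m : I → ℕ := fun i => pt (μ i) i
  have hm : l < ∑ i, m i := by
    by_contra! hm
    let y : T := ⟨fun i => m i + Pi.single (M := fun _ => ℕ) i₀ (l - ∑ i, m i) i, by
      simp [mem_piAntidiag, sum_add_distrib, hm]⟩
    obtain ⟨i, hi⟩ := hdom (Sum.inl y)
    have := hRle _ _ _ (hi _ (hμS i))
    change m i + _ + 1 ≤ m i at this
    omega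
  have hslack : ∀ i, (Sum.inr i : V) ∈ S → m i = 0 := fun i hi => by
    simpa [pt] using hμ i _ hi
  have hbound : ∀ x : T, Sum.inl x ∈ S → ∀ i,
      m i ≤ x.1 i + 1 ∧ x.1 i + 1 < m i + Fintype.card I := by
    intro x hx i
    have h1 : ∀ j, m j ≤ x.1 j + 1 := fun j => hμ j _ hx
    refine ⟨h1 i, ?_⟩
    have h2 : ∑ j, ((x.1 j : ℤ) + 1 - m j) < Fintype.card I := by
      have hm' : (l : ℤ) < ∑ j, (m j : ℤ) := by exact_mod_cast hm
      rw [sum_sub_distrib, sum_add_distrib, ← Nat.cast_sum, hT, sum_const, card_univ]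
      simp
      omega
    have h3 : (x.1 i : ℤ) + 1 - m i ≤ ∑ j, ((x.1 j : ℤ) + 1 - m j) :=
      single_le_sum (f := fun j => (x.1 j : ℤ) + 1 - m j)
        (fun j _ => by have := h1 j; omega) (mem_univ i)
    omega
  obtain ⟨x₀, hx₀⟩ : ∃ x : T, Sum.inl x ∈ S := by
    by_contra! hcon
    have : ∀ i, m i = 0 := by
      intro i
      obtain ⟨v | j, hv, hvi⟩ := hcol i
      · exact absurd hv (hcon v)
      · exact hvi ▸ hslack j hv
    simp [this] at hm
  refine ⟨sc x₀, hsc x₀, fun i => ?_⟩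
  obtain ⟨x | j, hv, hvi⟩ := hcol i
  · refine Or.inr ⟨sc x, hsc x, (dist_pi_le_iff hδ.le).2 fun j => ?_, hvi⟩
    have h1 := hbound x hv j
    have h2 := hbound x₀ hx₀ j
    rw [Real.dist_eq, ← sub_div, abs_div, abs_of_pos hlpos]
    refine le_trans (div_le_div_of_nonneg_right ?_ hlpos.le) hnl
    rw [abs_sub_le_iff, sub_le_iff_le_add, sub_le_iff_le_add]
    constructor <;> norm_cast <;> omega
  · left
    obtain rfl : j = i := hvi
    have h1 := hslack j hv
    have h2 := (hbound x₀ hx₀ j).2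
    refine le_trans (div_le_div_of_nonneg_right ?_ hlpos.le) hnl
    norm_cast
    omega

/-- **Brouwer's fixed point theorem** for the standard simplex. -/
theorem exists_fixedPoint_stdSimplex [Nonempty I] {f : (I → ℝ) → I → ℝ}
    (hf : ContinuousOn f (stdSimplex ℝ I)) (hmaps : Set.MapsTo f (stdSimplex ℝ I) (stdSimplex ℝ I)) :
    ∃ p ∈ stdSimplex ℝ I, f p = p := by
  have hcolour : ∀ p, ∃ i, p ∈ stdSimplex ℝ I → p i ≤ f p i := by
    intro p
    by_contra! hcon
    have hp := (hcon (Classical.arbitrary I)).1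
    have := sum_lt_sum_of_nonempty univ_nonempty fun i _ => (hcon i).2
    rw [hp.2, (hmaps hp).2] at this
    exact this.false
  choose c hc using hcolour
  have hδ : ∀ n : ℕ, (0 : ℝ) < 1 / (n + 1) := fun n => Nat.one_div_pos_of_nat
  have happ : ∀ n : ℕ, ∃ p ∈ stdSimplex ℝ I, ∀ i, ∃ q ∈ stdSimplex ℝ I,
      dist q p ≤ 1 / (n + 1) ∧ q i ≤ f q i + 1 / (n + 1) := by
    intro n
    obtain ⟨p, hp, h⟩ := exists_mem_stdSimplex_close_colours c (hδ n)
    refine ⟨p, hp, fun i => ?_⟩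
    rcases h i with h | ⟨q, hq, hqp, rfl⟩
    · refine ⟨p, hp, by simpa using (hδ n).le, ?_⟩
      have := (hmaps hp).1 i
      linarith
    · refine ⟨q, hq, hqp, ?_⟩
      have h1 := hc q hq
      have h2 := hδ n
      linarith
  choose p hp q hq hqp hqf using happ
  obtain ⟨p₀, hp₀, φ, hφ, hlim⟩ := (isCompact_stdSimplex ℝ I).tendsto_subseq hp
  have hδlim : Filter.Tendsto (fun n => 1 / ((φ n : ℝ) + 1)) Filter.atTop (nhds 0) :=
    tendsto_one_div_add_atTop_nhds_zero_nat.comp hφ.tendsto_atTop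
  have hle : ∀ i, p₀ i ≤ f p₀ i := by
    intro i
    have hqlim : Filter.Tendsto (fun n => q (φ n) i) Filter.atTop (nhds p₀) :=
      (tendsto_iff_of_dist (squeeze_zero (fun _ => dist_nonneg) (fun n => hqp (φ n) i) hδlim)).2 hlim
    have hflim : Filter.Tendsto (fun n => f (q (φ n) i)) Filter.atTop (nhds (f p₀)) :=
      (hf p₀ hp₀).tendsto.comp (tendsto_nhdsWithin_iff.2
        ⟨hqlim, Filter.Eventually.of_forall fun n => hq (φ n) i⟩)
    have h1 := ((continuous_apply i).tendsto p₀).comp hqlim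
    have h2 := (((continuous_apply i).tendsto (f p₀)).comp hflim).add hδlim
    rw [add_zero] at h2
    exact le_of_tendsto_of_tendsto' h1 h2 fun n => hqf (φ n) i
  refine ⟨p₀, hp₀, funext fun i => ?_⟩
  have hsum : ∑ i, p₀ i = ∑ i, f p₀ i := by rw [hp₀.2, (hmaps hp₀).2]
  exact ((sum_eq_sum_iff_of_le fun i _ => hle i).1 hsum i (mem_univ i)).symm

/-- A continuous vector field `z` on the simplex has a point `p` maximising `q ↦ q ⬝ z p`. -/
theorem exists_stdSimplex_forall_le_sum [Nonempty I] {z : (I → ℝ) → I → ℝ}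
    (hz : ContinuousOn z (stdSimplex ℝ I)) :
    ∃ p ∈ stdSimplex ℝ I, ∀ i, z p i ≤ ∑ j, p j * z p j := by
  let g : (I → ℝ) → I → ℝ := fun p i => max (z p i - ∑ j, p j * z p j) 0
  have hg0 : ∀ p i, 0 ≤ g p i := fun p i => le_max_right _ _
  have hzi : ∀ i, ContinuousOn (fun p => z p i) (stdSimplex ℝ I) := fun i =>
    (continuous_apply i).comp_continuousOn hz
  have hgi : ∀ i, ContinuousOn (fun p => g p i) (stdSimplex ℝ I) := fun i =>
    ContinuousOn.sup ((hzi i).sub (continuousOn_finsetSum _ fun j _ =>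
      (continuous_apply j).continuousOn.mul (hzi j))) continuousOn_const
  have hden : ∀ p, 0 < 1 + ∑ j, g p j := fun p => by
    have := sum_nonneg fun j (_ : j ∈ univ) => hg0 p j
    linarith
  obtain ⟨p, hp, hfix⟩ := exists_fixedPoint_stdSimplex
    (f := fun p i => (p i + g p i) / (1 + ∑ j, g p j))
    (continuousOn_pi.2 fun i => ((continuous_apply i).continuousOn.add (hgi i)).div
      (continuousOn_const.add (continuousOn_finsetSum _ fun j _ => hgi j))
      fun p _ => (hden p).ne')
    (fun p hp => ⟨fun i => div_nonneg (add_nonneg (hp.1 i) (hg0 p i)) (hden p).le, by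
      rw [← sum_div, sum_add_distrib, hp.2, div_self (hden p).ne']⟩)
  refine ⟨p, hp, ?_⟩
  have hfix' : ∀ i, g p i = p i * ∑ j, g p j := fun i => by
    have := congrFun hfix i
    rw [div_eq_iff (hden p).ne'] at this
    linarith
  obtain ⟨k, hk, hkz⟩ : ∃ k, 0 < p k ∧ z p k ≤ ∑ j, p j * z p j := by
    by_contra! hcon
    have hle : ∀ i ∈ univ, p i * ∑ j, p j * z p j ≤ p i * z p i := by
      intro i _
      rcases (hp.1 i).eq_or_lt with h | h
      · simp [← h]
      · exact mul_le_mul_of_nonneg_left (hcon i h).le h.le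
    obtain ⟨i, hi⟩ : ∃ i, 0 < p i := by
      by_contra! hneg
      have := sum_nonpos fun i (_ : i ∈ univ) => hneg i
      rw [hp.2] at this
      linarith
    have := sum_lt_sum hle ⟨i, mem_univ i, mul_lt_mul_of_pos_left (hcon i hi) hi⟩
    rw [← sum_mul, hp.2, one_mul] at this
    exact this.false
  have hS : ∑ j, g p j = 0 := by
    have h1 : g p k = 0 := max_eq_right (by linarith)
    have h2 := hfix' k
    rw [h1] at h2
    exact (mul_eq_zero.1 h2.symm).resolve_left hk.ne'
  intro i
  have h1 := hfix' i
  rw [hS, mul_zero] at h1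
  have h2 : z p i - ∑ j, p j * z p j ≤ g p i := le_max_left _ _
  linarith

end Brouwer

section Correspondence

variable {I E : Type*} [Fintype I] [NormedAddCommGroup E] [NormedSpace ℝ E]

/-- Approximate selection: values near the graph of `D` in the convex-hull sense, at which the
variational inequality holds. -/
theorem exists_mem_convexHull_forall_le_sum [Nonempty I] {D : (I → ℝ) → Set E}
    (hne : ∀ p ∈ stdSimplex ℝ I, (D p).Nonempty) {g : E → I → ℝ} (hg : Continuous g)
    {δ : ℝ} (hδ : 0 < δ) :
    ∃ p ∈ stdSimplex ℝ I, ∃ x ∈ convexHull ℝ {y | ∃ k ∈ stdSimplex ℝ I, dist k p < δ ∧ y ∈ D k},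
      ∀ i, g x i ≤ ∑ j, p j * g x j := by
  classical
  have hsel : ∀ p, ∃ x, p ∈ stdSimplex ℝ I → x ∈ D p := fun p => by
    by_cases hp : p ∈ stdSimplex ℝ I
    · exact (hne p hp).imp fun _ h _ => h
    · exact ⟨0, fun h => absurd h hp⟩
  choose sel hsel using hsel
  obtain ⟨t, htΔ, htfin, hcov⟩ := (isCompact_stdSimplex ℝ I).finite_cover_balls hδ
  lift t to Finset (I → ℝ) using htfin
  let w : (I → ℝ) → (I → ℝ) → ℝ := fun p k => max (δ - dist k p) 0
  have hw0 : ∀ p k, 0 ≤ w p k := fun p k => le_max_right _ _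
  have hwcont : ∀ k, Continuous fun p => w p k := fun k => by
    simp only [w]
    fun_prop
  have hwpos : ∀ p ∈ stdSimplex ℝ I, 0 < ∑ k ∈ t, w p k := by
    intro p hp
    obtain ⟨k, hk, hkp⟩ := Set.mem_iUnion₂.1 (hcov hp)
    refine sum_pos' (fun k _ => hw0 p k) ⟨k, hk, lt_max_of_lt_left ?_⟩
    rw [Metric.mem_ball, dist_comm] at hkp
    linarith
  have hcont : ContinuousOn (fun p => t.centerMass (w p) sel) (stdSimplex ℝ I) := by
    refine ContinuousOn.smul (ContinuousOn.inv₀ ?_ fun p hp => (hwpos p hp).ne') ?_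
    · exact continuousOn_finsetSum _ fun k _ => (hwcont k).continuousOn
    · exact continuousOn_finsetSum _ fun k _ => (hwcont k).continuousOn.smul continuousOn_const
  obtain ⟨p, hp, hVI⟩ := exists_stdSimplex_forall_le_sum (hg.comp_continuousOn hcont)
  refine ⟨p, hp, _, ?_, hVI⟩
  change t.centerMass (w p) sel ∈ _
  rw [← centerMass_filter_ne_zero]
  refine centerMass_mem_convexHull _ (fun k _ => hw0 p k) ?_ fun k hk => ?_
  · rw [sum_filter_ne_zero]
    exact hwpos p hp
  · rw [mem_filter] at hk
    refine ⟨k, htΔ hk.1, ?_, hsel k (htΔ hk.1)⟩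
    by_contra! hcon
    exact hk.2 (max_eq_right (by linarith))

/-- A Gale–Nikaido–Debreu theorem for a convex-valued correspondence with closed graph. -/
theorem exists_mem_forall_le_sum_of_closed_graph [Nonempty I] {K : Set E} (hK : IsCompact K)
    (hKc : Convex ℝ K) {D : (I → ℝ) → Set E}
    (hDK : ∀ p ∈ stdSimplex ℝ I, D p ⊆ K) (hne : ∀ p ∈ stdSimplex ℝ I, (D p).Nonempty)
    (hcvx : ∀ p ∈ stdSimplex ℝ I, Convex ℝ (D p))
    (hclosed : ∀ (p : ℕ → I → ℝ) (x : ℕ → E) (p₀ : I → ℝ) (x₀ : E),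
      (∀ n, p n ∈ stdSimplex ℝ I) → p₀ ∈ stdSimplex ℝ I → (∀ n, x n ∈ D (p n)) →
      Filter.Tendsto p Filter.atTop (nhds p₀) → Filter.Tendsto x Filter.atTop (nhds x₀) →
      x₀ ∈ D p₀)
    {g : E → I → ℝ} (hg : Continuous g) :
    ∃ p ∈ stdSimplex ℝ I, ∃ x ∈ D p, ∀ i, g x i ≤ ∑ j, p j * g x j := by
  have hδ : ∀ n : ℕ, (0 : ℝ) < 1 / (n + 1) := fun n => Nat.one_div_pos_of_nat
  have hδlim := tendsto_one_div_add_atTop_nhds_zero_nat (𝕜 := ℝ)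
  choose p hp x hx hVI using fun n : ℕ => exists_mem_convexHull_forall_le_sum hne hg (hδ n)
  have hxK : ∀ n, x n ∈ K := fun n => by
    refine convexHull_min ?_ hKc (hx n)
    rintro y ⟨k, hk, -, hy⟩
    exact hDK k hk hy
  obtain ⟨⟨p₀, x₀⟩, ⟨hp₀, hx₀⟩, φ, hφ, hlim⟩ := ((isCompact_stdSimplex ℝ I).prod hK).tendsto_subseq
    (x := fun n => (p n, x n)) fun n => ⟨hp n, hxK n⟩
  have hplim : Filter.Tendsto (fun n => p (φ n)) Filter.atTop (nhds p₀) :=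
    (continuous_fst.tendsto _).comp hlim
  have hxlim : Filter.Tendsto (fun n => x (φ n)) Filter.atTop (nhds x₀) :=
    (continuous_snd.tendsto _).comp hlim
  have husc : ∀ η : ℝ, 0 < η → ∃ r > 0, ∀ k ∈ stdSimplex ℝ I, dist k p₀ < r →
      D k ⊆ Metric.thickening η (D p₀) := by
    intro η hη
    by_contra! hcon
    choose k hk hkp hkD using fun n : ℕ => hcon _ (hδ n)
    choose y hyD hy using fun n => Set.not_subset.1 (hkD n)
    obtain ⟨y₀, hy₀, ψ, hψ, hylim⟩ := hK.tendsto_subseq fun n => hDK _ (hk n) (hyD n)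
    have hklim : Filter.Tendsto k Filter.atTop (nhds p₀) :=
      tendsto_iff_dist_tendsto_zero.2
        (squeeze_zero (fun _ => dist_nonneg) (fun n => (hkp n).le) hδlim)
    have hmem := hclosed _ _ p₀ y₀ (fun n => hk (ψ n)) hp₀ (fun n => hyD (ψ n))
      (hklim.comp hψ.tendsto_atTop) hylim
    exact Metric.isOpen_thickening.isClosed_compl.mem_of_tendsto hylim
      (Filter.Eventually.of_forall fun n => hy (ψ n)) (Metric.self_subset_thickening hη _ hmem)
  have hclosed₀ : IsClosed (D p₀) := IsSeqClosed.isClosed fun y y₀ hy hlim =>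
    hclosed (fun _ => p₀) y p₀ y₀ (fun _ => hp₀) hp₀ hy tendsto_const_nhds hlim
  have hxD : x₀ ∈ D p₀ := by
    rw [← hclosed₀.closure_eq, Metric.closure_eq_iInter_cthickening]
    refine Set.mem_iInter₂.2 fun η hη => ?_
    obtain ⟨r, hr, hrD⟩ := husc η hη
    have h1 : ∀ᶠ n in Filter.atTop, dist (p (φ n)) p₀ < r / 2 :=
      (tendsto_iff_dist_tendsto_zero.1 hplim).eventually_lt_const (half_pos hr)
    have h2 : ∀ᶠ n in Filter.atTop, 1 / ((φ n : ℝ) + 1) < r / 2 :=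
      (hδlim.comp hφ.tendsto_atTop).eventually_lt_const (half_pos hr)
    refine Metric.closure_thickening_subset_cthickening _ _
      (mem_closure_of_tendsto hxlim ?_)
    filter_upwards [h1, h2] with n h1 h2
    refine convexHull_min ?_ ((hcvx p₀ hp₀).thickening η) (hx (φ n))
    rintro y ⟨k, hk, hkp, hy⟩
    refine hrD k hk ?_ hy
    linarith [dist_triangle k (p (φ n)) p₀]
  refine ⟨p₀, hp₀, x₀, hxD, fun i => ?_⟩
  have hgi : ∀ j, Filter.Tendsto (fun n => g (x (φ n)) j) Filter.atTop (nhds (g x₀ j)) := fun j =>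
    (((continuous_apply j).comp hg).tendsto x₀).comp hxlim
  exact le_of_tendsto_of_tendsto' (hgi i)
    (tendsto_finsetSum _ fun j _ => (((continuous_apply j).tendsto p₀).comp hplim).mul (hgi j))
    fun n => hVI (φ n) i

end Correspondence

section Demand

variable {O : Type*} [Fintype O]

theorem dotO_smul (w z : O → ℝ) (t : ℝ) : dotO w (t • z) = t * dotO w z := by
  simp only [dotO, Pi.smul_apply, smul_eq_mul, mul_sum]
  exact sum_congr rfl fun _ _ => by ring

theorem dotO_add (w y z : O → ℝ) : dotO w (y + z) = dotO w y + dotO w z := by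
  simp [dotO, mul_add, sum_add_distrib]

theorem dotO_mono {w y z : O → ℝ} (hw : ∀ l, 0 ≤ w l) (h : ∀ l, y l ≤ z l) :
    dotO w y ≤ dotO w z :=
  sum_le_sum fun l _ => mul_le_mul_of_nonneg_left (h l) (hw l)

theorem continuous_dotO : Continuous fun q : (O → ℝ) × (O → ℝ) => dotO q.1 q.2 := by
  unfold dotO
  fun_prop

/-- The cheapest among the `u`-maximal bundles in the budget set of `X` at prices `w` and
income `β`. -/
def cheapestDemand (X : Set (O → ℝ)) (u : (O → ℝ) → ℝ) (w : O → ℝ) (β : ℝ) : Set (O → ℝ) :=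
  {x | x ∈ X ∧ dotO w x ≤ β ∧ (∀ z ∈ X, dotO w z ≤ β → u z ≤ u x) ∧
    ∀ z ∈ X, dotO w z ≤ β → u x ≤ u z → dotO w x ≤ dotO w z}

variable {X : Set (O → ℝ)} {u : (O → ℝ) → ℝ}

theorem cheapestDemand_nonempty (hX : IsCompact X) (h0 : (0 : O → ℝ) ∈ X) (hu : ContinuousOn u X)
    (w : O → ℝ) {β : ℝ} (hβ : 0 ≤ β) : (cheapestDemand X u w β).Nonempty := by
  have hw : Continuous (dotO w) := continuous_dotO.comp (Continuous.prodMk_right w)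
  have hB : IsCompact (X ∩ {z | dotO w z ≤ β}) := hX.inter_right (isClosed_le hw continuous_const)
  have huB : ContinuousOn u (X ∩ {z | dotO w z ≤ β}) := hu.mono Set.inter_subset_left
  obtain ⟨y, hy, hymax⟩ := hB.exists_isMaxOn ⟨0, h0, by simpa [dotO] using hβ⟩ huB
  have hA : IsCompact ((X ∩ {z | dotO w z ≤ β}) ∩ u ⁻¹' Set.Ici (u y)) :=
    hB.of_isClosed_subset (huB.preimage_isClosed_of_isClosed hB.isClosed isClosed_Ici)
      Set.inter_subset_left
  obtain ⟨x, hx, hxmin⟩ := hA.exists_isMinOn ⟨y, hy, le_refl (u y)⟩ hw.continuousOn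
  refine ⟨x, hx.1.1, hx.1.2, fun z hz hzβ => (hymax ⟨hz, hzβ⟩).trans hx.2,
    fun z hz hzβ hxz => hxmin ⟨⟨hz, hzβ⟩, le_trans hx.2 hxz⟩⟩

theorem convex_cheapestDemand (hX : Convex ℝ X)
    (hqc : ∀ z ∈ X, ∀ y ∈ X, ∀ t : ℝ, 0 ≤ t → t ≤ 1 → min (u z) (u y) ≤ u (t • z + (1 - t) • y))
    (w : O → ℝ) (β : ℝ) : Convex ℝ (cheapestDemand X u w β) := by
  rintro x ⟨hxX, hxβ, hxu, hxw⟩ y ⟨hyX, hyβ, hyu, hyw⟩ s t hs ht hst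
  obtain rfl : t = 1 - s := by linarith
  have hxy : u x = u y := le_antisymm (hyu x hxX hxβ) (hxu y hyX hyβ)
  have hcost : dotO w x = dotO w y :=
    le_antisymm (hxw y hyX hyβ hxy.le) (hyw x hxX hxβ hxy.ge)
  have hmix : dotO w (s • x + (1 - s) • y) = dotO w x := by
    rw [dotO_add, dotO_smul, dotO_smul, hcost]; ring
  have hu : u x ≤ u (s • x + (1 - s) • y) := by
    simpa [hxy] using hqc x hxX y hyX s hs (by linarith)
  refine ⟨hX hxX hyX hs ht hst, hmix.trans_le hxβ, fun z hz hzβ => (hxu z hz hzβ).trans hu,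
    fun z hz hzβ hle => hmix.trans_le (hxw z hz hzβ (hu.trans hle))⟩

theorem mem_cheapestDemand_of_tendsto (hXc : IsClosed X) (hX : Convex ℝ X)
    (h0 : (0 : O → ℝ) ∈ X) (hu : ContinuousOn u X)
    (hss : ∀ z ∈ X, ∀ y ∈ X, ∀ t : ℝ, 0 < t → t < 1 → u z ≠ u y →
      min (u z) (u y) < u (t • z + (1 - t) • y))
    {w : ℕ → O → ℝ} {β : ℕ → ℝ} {x : ℕ → O → ℝ} {w₀ : O → ℝ} {β₀ : ℝ} {x₀ : O → ℝ}
    (hw : Filter.Tendsto w Filter.atTop (nhds w₀)) (hβ : Filter.Tendsto β Filter.atTop (nhds β₀))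
    (hx : Filter.Tendsto x Filter.atTop (nhds x₀)) (hβ₀ : 0 < β₀)
    (hmem : ∀ n, x n ∈ cheapestDemand X u (w n) (β n)) :
    x₀ ∈ cheapestDemand X u w₀ β₀ := by
  have hx₀ : x₀ ∈ X := hXc.mem_of_tendsto hx (Filter.Eventually.of_forall fun n => (hmem n).1)
  have hux : Filter.Tendsto (fun n => u (x n)) Filter.atTop (nhds (u x₀)) :=
    (hu x₀ hx₀).tendsto.comp (tendsto_nhdsWithin_iff.2
      ⟨hx, Filter.Eventually.of_forall fun n => (hmem n).1⟩)
  have hwx : Filter.Tendsto (fun n => dotO (w n) (x n)) Filter.atTop (nhds (dotO w₀ x₀)) :=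
    (continuous_dotO.tendsto (w₀, x₀)).comp (hw.prodMk_nhds hx)
  have hwz : ∀ z, Filter.Tendsto (fun n => dotO (w n) z) Filter.atTop (nhds (dotO w₀ z)) :=
    fun z => (continuous_dotO.tendsto (w₀, z)).comp (hw.prodMk_nhds tendsto_const_nhds)
  have hlt : ∀ z ∈ X, dotO w₀ z < β₀ → u z ≤ u x₀ := by
    intro z hz hzβ
    refine ge_of_tendsto hux ?_
    filter_upwards [(hwz z).eventually_lt hβ hzβ] with n hn
    exact (hmem n).2.2.1 z hz hn.le
  have hmax : ∀ z ∈ X, dotO w₀ z ≤ β₀ → u z ≤ u x₀ := by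
    intro z hz hzβ
    have hscale : Filter.Tendsto (fun n : ℕ => (1 - 1 / ((n : ℝ) + 1)) • z) Filter.atTop (nhds z) := by
      have := (tendsto_const_nhds (x := (1 : ℝ))).sub
        (tendsto_one_div_add_atTop_nhds_zero_nat (𝕜 := ℝ))
      simpa using this.smul_const z
    have hn : ∀ n : ℕ, 0 < 1 / ((n : ℝ) + 1) ∧ 1 / ((n : ℝ) + 1) ≤ 1 := fun n =>
      ⟨Nat.one_div_pos_of_nat, (div_le_one (by positivity)).2 (by linarith [n.cast_nonneg (α := ℝ)])⟩
    have hmemX : ∀ n : ℕ, (1 - 1 / ((n : ℝ) + 1)) • z ∈ X := fun n =>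
      hX.smul_mem_of_zero_mem h0 hz ⟨by linarith [(hn n).2], by linarith [(hn n).1]⟩
    refine le_of_tendsto ((hu z hz).tendsto.comp (tendsto_nhdsWithin_iff.2
      ⟨hscale, Filter.Eventually.of_forall hmemX⟩)) (Filter.Eventually.of_forall fun n => ?_)
    refine hlt _ (hmemX n) ?_
    rw [dotO_smul]
    have h1 := mul_le_mul_of_nonneg_left hzβ (sub_nonneg.2 (hn n).2)
    have h2 := mul_pos (hn n).1 hβ₀
    linarith
  refine ⟨hx₀, le_of_tendsto_of_tendsto' hwx hβ fun n => (hmem n).2.1, hmax, ?_⟩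
  intro z hz hzβ hxz
  by_contra! hcon
  have hzlt : dotO w₀ z < β₀ :=
    hcon.trans_le (le_of_tendsto_of_tendsto' hwx hβ fun n => (hmem n).2.1)
  by_cases hsat : ∃ y ∈ X, u z < u y
  · obtain ⟨y, hy, hzy⟩ := hsat
    have hlim : Filter.Tendsto (fun t : ℝ => dotO w₀ (t • y + (1 - t) • z)) (nhdsWithin 0 (Set.Ioi 0))
        (nhds (dotO w₀ z)) := by
      have hcont : Continuous fun t : ℝ => dotO w₀ (t • y + (1 - t) • z) :=
        continuous_dotO.comp (by fun_prop : Continuous fun t : ℝ => (w₀, t • y + (1 - t) • z))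
      simpa using (hcont.tendsto 0).mono_left nhdsWithin_le_nhds
    obtain ⟨t, ht, ht0, ht1⟩ := ((hlim.eventually_lt_const hzlt).and
      (Ioo_mem_nhdsGT (zero_lt_one (α := ℝ)))).exists
    have h1 := hss y hy z hz t ht0 ht1 hzy.ne'
    rw [min_eq_right hzy.le] at h1
    have h2 := hmax _ (hX hy hz ht0.le (sub_nonneg.2 ht1.le) (by ring)) ht.le
    linarith
  · push Not at hsat
    refine hcon.not_ge (le_of_tendsto_of_tendsto hwx (hwz z) ?_)
    filter_upwards [(hwz z).eventually_lt hβ hzlt] with n hn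
    exact (hmem n).2.2.2 z hz hn.le (hsat _ (hmem n).1)

end Demand

section Market

variable {I O C : Type*} [Fintype C]

theorem continuous_pers (a : C → I → O → ℝ) (i : I) : Continuous fun p : C → ℝ => pers a p i := by
  unfold pers
  fun_prop

theorem pers_nonneg {a : C → I → O → ℝ} (ha : ∀ c i l, 0 ≤ a c i l) {p : C → ℝ}
    (hp : ∀ c, 0 ≤ p c) (i : I) (l : O) : 0 ≤ pers a p i l :=
  sum_nonneg fun c _ => mul_nonneg (ha c i l) (hp c)

variable [Fintype I] [Fintype O]

theorem sum_dotO_pers (a : C → I → O → ℝ) (p : C → ℝ) (x : I → O → ℝ) :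
    ∑ i, dotO (pers a p i) (x i) = ∑ c, p c * dotIO (a c) x := by
  simp only [dotO, pers, dotIO, mul_sum, sum_mul]
  rw [sum_comm (s := (univ : Finset C))]
  refine sum_congr rfl fun i _ => ?_
  rw [sum_comm]
  exact sum_congr rfl fun c _ => sum_congr rfl fun l _ => by ring

/-- Existence of prices and cheapest demands clearing all constraints, for slack `α > 0`. -/
theorem exists_slack_market_clearing (X : I → Set (O → ℝ))
    (hXcpt : ∀ i, IsCompact (X i)) (hXcvx : ∀ i, Convex ℝ (X i))
    (hX0 : ∀ i, (0 : O → ℝ) ∈ X i) (hXnn : ∀ i, ∀ z ∈ X i, ∀ l, 0 ≤ z l)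
    (a : C → I → O → ℝ) (b : C → ℝ) (ha : ∀ c i l, 0 ≤ a c i l) (hb : ∀ c, 0 < b c)
    (u : I → (O → ℝ) → ℝ) (hu : ∀ i, ContinuousOn (u i) (X i))
    (hqc : ∀ i, ∀ z ∈ X i, ∀ y ∈ X i, ∀ t : ℝ, 0 ≤ t → t ≤ 1 →
      min (u i z) (u i y) ≤ u i (t • z + (1 - t) • y))
    (hss : ∀ i, ∀ z ∈ X i, ∀ y ∈ X i, ∀ t : ℝ, 0 < t → t < 1 → u i z ≠ u i y →
      min (u i z) (u i y) < u i (t • z + (1 - t) • y))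
    (ω : I → O → ℝ) (hωX : ∀ i, ω i ∈ X i) (hωb : ∀ c, dotIO (a c) ω ≤ b c)
    {α : ℝ} (hα : 0 < α) (hα1 : α ≤ 1) :
    ∃ (p : C → ℝ) (x : I → O → ℝ), (∀ c, 0 ≤ p c) ∧
      (∀ i, x i ∈ cheapestDemand (X i) (u i) (pers a p i)
        (α + (1 - α) * dotO (pers a p i) (ω i))) ∧
      (∀ c, dotIO (a c) x ≤ b c) ∧ ∀ c, dotIO (a c) x < b c → p c = 0 := by
  let M : ℝ := Fintype.card I + 1
  have hM : 0 < M := by positivity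
  let π : (Option C → ℝ) → C → ℝ := fun q c => M * q (some c) / b c
  have hπcont : Continuous π := by
    simp only [π]
    fun_prop
  have hπnn : ∀ q ∈ stdSimplex ℝ (Option C), ∀ c, 0 ≤ π q c := fun q hq c =>
    div_nonneg (mul_nonneg hM.le (hq.1 _)) (hb c).le
  let β : (Option C → ℝ) → I → ℝ := fun q i => α + (1 - α) * dotO (pers a (π q) i) (ω i)
  have hwcont : ∀ i, Continuous fun q => pers a (π q) i := fun i =>
    (continuous_pers a i).comp hπcont
  have hβcont : ∀ i, Continuous fun q => β q i := fun i =>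
    continuous_const.add (continuous_const.mul
      (continuous_dotO.comp ((hwcont i).prodMk continuous_const)))
  have hβpos : ∀ q ∈ stdSimplex ℝ (Option C), ∀ i, 0 < β q i := fun q hq i => by
    have h1 : 0 ≤ dotO (pers a (π q) i) (ω i) := sum_nonneg fun l _ =>
      mul_nonneg (pers_nonneg ha (hπnn q hq) i l) (hXnn i _ (hωX i) l)
    have h2 := mul_nonneg (sub_nonneg.2 hα1) h1
    simp only [β]
    linarith
  let D : (Option C → ℝ) → Set (I → O → ℝ) := fun q =>
    Set.univ.pi fun i => cheapestDemand (X i) (u i) (pers a (π q) i) (β q i)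
  let g : (I → O → ℝ) → Option C → ℝ := fun x o => o.elim 0 fun c => (dotIO (a c) x - b c) / b c
  have hg : Continuous g := by
    refine continuous_pi fun o => ?_
    cases o with
    | none => exact continuous_const
    | some c =>
      simp only [g, dotIO, Option.elim_some]
      fun_prop
  obtain ⟨q, hq, x, hxD, hVI⟩ := exists_mem_forall_le_sum_of_closed_graph
    (K := Set.univ.pi X) (isCompact_univ_pi hXcpt) (convex_pi fun i _ => hXcvx i) (D := D)
    (fun q _ => Set.pi_mono fun i _ _ h => h.1)
    (fun q hq => Set.univ_pi_nonempty_iff.2 fun i =>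
      cheapestDemand_nonempty (hXcpt i) (hX0 i) (hu i) _ (hβpos q hq i).le)
    (fun q _ => convex_pi fun i _ => convex_cheapestDemand (hXcvx i) (hqc i) _ _)
    (fun q x q₀ x₀ _ hq₀ hx hqlim hxlim i _ =>
      mem_cheapestDemand_of_tendsto (hXcpt i).isClosed (hXcvx i) (hX0 i) (hu i) (hss i)
        (((hwcont i).tendsto q₀).comp hqlim) (((hβcont i).tendsto q₀).comp hqlim)
        (((continuous_apply i).tendsto x₀).comp hxlim) (hβpos q₀ hq₀ i)
        fun n => hx n i (Set.mem_univ i))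
    hg
  have hx : ∀ i, x i ∈ cheapestDemand (X i) (u i) (pers a (π q) i) (β q i) := fun i =>
    hxD i (Set.mem_univ i)
  set v := ∑ o, q o * g x o with hv
  have hv0 : 0 ≤ v := hVI none
  have hcomp : ∀ o, q o = 0 ∨ g x o = v := by
    have hsum : ∑ o, q o * (v - g x o) = 0 := by
      simp only [mul_sub]
      rw [sum_sub_distrib, ← sum_mul, hq.2, one_mul, ← hv, sub_self]
    intro o
    have := (sum_eq_zero_iff_of_nonneg fun o _ =>
      mul_nonneg (hq.1 o) (sub_nonneg.2 (hVI o))).1 hsum o (mem_univ o)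
    rcases mul_eq_zero.1 this with h | h
    · exact Or.inl h
    · exact Or.inr (by linarith)
  have hMv : M * v = ∑ c, π q c * dotIO (a c) x - ∑ c, π q c * b c := by
    rw [hv, Fintype.sum_option, ← sum_sub_distrib]
    simp only [g, Option.elim_none, mul_zero, zero_add, Option.elim_some]
    rw [mul_sum]
    refine sum_congr rfl fun c _ => ?_
    simp only [π]
    ring
  have hwalras : ∑ c, π q c * dotIO (a c) x ≤
      α * Fintype.card I + (1 - α) * ∑ c, π q c * b c := by
    rw [← sum_dotO_pers]
    calc ∑ i, dotO (pers a (π q) i) (x i) ≤ ∑ i, β q i := sum_le_sum fun i _ => (hx i).2.1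
      _ = α * Fintype.card I + (1 - α) * ∑ c, π q c * dotIO (a c) ω := by
        rw [← sum_dotO_pers, mul_sum, sum_add_distrib]
        simp [mul_comm]
      _ ≤ _ := add_le_add le_rfl (mul_le_mul_of_nonneg_left (sum_le_sum fun c _ =>
        mul_le_mul_of_nonneg_left (hωb c) (hπnn q hq c)) (sub_nonneg.2 hα1))
  have hvz : v = 0 := by
    by_contra hne
    have hq0 : q none = 0 := (hcomp none).resolve_right fun h => hne h.symm
    have hqs : ∑ c, π q c * b c = M := by
      have h1 := hq.2
      rw [Fintype.sum_option, hq0, zero_add] at h1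
      have h2 : ∀ c, π q c * b c = M * q (some c) := fun c => div_mul_cancel₀ _ (hb c).ne'
      rw [sum_congr rfl fun c _ => h2 c, ← mul_sum, h1, mul_one]
    rw [hqs] at hMv hwalras
    have h3 : M * v ≤ -α := by simp only [M] at *; linarith
    have h4 := mul_nonneg hM.le hv0
    linarith
  rw [hvz] at hVI hcomp
  refine ⟨π q, x, hπnn q hq, hx, fun c => ?_, fun c hc => ?_⟩
  · have := hVI (some c)
    simp only [g, Option.elim_some] at this
    by_contra! hlt
    exact (div_pos (sub_pos.2 hlt) (hb c)).not_ge this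
  · have hgc : g x (some c) ≠ 0 := (div_neg_of_neg_of_pos (sub_neg.2 hc) (hb c)).ne
    simp [π, (hcomp (some c)).resolve_right hgc]

end Market

/-- Small multiplicative discounts change a continuous function on a compact set uniformly little. -/
theorem eventually_forall_sub_smul_lt {E : Type*} [NormedAddCommGroup E] [NormedSpace ℝ E]
    {X : Set E} (hX : IsCompact X) (hXc : Convex ℝ X) (h0 : (0 : E) ∈ X) {u : E → ℝ}
    (hu : ContinuousOn u X) {ε : ℝ} (hε : 0 < ε) :
    ∀ᶠ α in nhdsWithin (0 : ℝ) (Set.Ioi 0), ∀ y ∈ X, u y - u ((1 - α) • y) < ε := by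
  obtain ⟨δ, hδ, h⟩ := Metric.uniformContinuousOn_iff.1
    (hX.uniformContinuousOn_of_continuous hu) ε hε
  obtain ⟨B, hB, hXB⟩ := hX.isBounded.exists_pos_norm_le
  filter_upwards [Ioo_mem_nhdsGT (lt_min one_pos (div_pos hδ hB))] with α hα y hy
  obtain ⟨h0α, hα⟩ := hα
  rw [lt_min_iff, lt_div_iff₀ hB] at hα
  refine (le_abs_self _).trans_lt (h y hy _ (hXc.smul_mem_of_zero_mem h0 hy
    ⟨by linarith, by linarith⟩) ?_)
  rw [dist_eq_norm, sub_smul, one_smul, sub_sub_cancel, norm_smul, Real.norm_of_nonneg h0α.le]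
  exact (mul_le_mul_of_nonneg_left (hXB y hy) h0α.le).trans_lt hα.2

theorem statement7 {I O C : Type*} [Fintype I] [Fintype O] [Fintype C]
    [Nonempty I] [Nonempty O]
    (S : Finset (I → O → ℝ)) (hSne : S.Nonempty)
    (𝒞 : Set (I → O → ℝ)) (h𝒞 : 𝒞 = convexHull ℝ (S : Set (I → O → ℝ)))
    (h𝒞nn : ∀ x ∈ 𝒞, ∀ i l, 0 ≤ x i l)
    (X : I → Set (O → ℝ))
    (hXnn : ∀ i, ∀ z ∈ X i, ∀ l, 0 ≤ z l)
    (hXcpt : ∀ i, IsCompact (X i))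
    (hXcvx : ∀ i, Convex ℝ (X i))
    (hX0 : ∀ i, (0 : O → ℝ) ∈ X i)
    (hXdc : ∀ i, ∀ y z : O → ℝ, (∀ l, 0 ≤ y l) → (∀ l, y l ≤ z l) → z ∈ X i → y ∈ X i)
    (a : C → I → O → ℝ) (b : C → ℝ)
    (ha : ∀ c i l, 0 ≤ a c i l) (hb : ∀ c, 0 < b c)
    (hlcs : {x : I → O → ℝ | (∀ i l, 0 ≤ x i l) ∧ ∃ x' ∈ 𝒞, ∀ i l, x i l ≤ x' i l}
      = {x : I → O → ℝ | (∀ i l, 0 ≤ x i l) ∧ (∀ i, x i ∈ X i) ∧ ∀ c, dotIO (a c) x ≤ b c})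
    (u : I → (O → ℝ) → ℝ)
    (hu_cont : ∀ i, ContinuousOn (u i) {z : O → ℝ | ∀ l, 0 ≤ z l})
    (hu_qc : ∀ i, ∀ z ∈ {z : O → ℝ | ∀ l, 0 ≤ z l}, ∀ w ∈ {z : O → ℝ | ∀ l, 0 ≤ z l},
      ∀ t : ℝ, 0 ≤ t → t ≤ 1 → min (u i z) (u i w) ≤ u i (t • z + (1 - t) • w))
    (hu_ssqc : ∀ i, ∀ z ∈ {z : O → ℝ | ∀ l, 0 ≤ z l}, ∀ w ∈ {z : O → ℝ | ∀ l, 0 ≤ z l},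
      ∀ t : ℝ, 0 < t → t < 1 → u i z ≠ u i w →
        min (u i z) (u i w) < u i (t • z + (1 - t) • w))
    (hu_mono : ∀ i, ∀ z ∈ {z : O → ℝ | ∀ l, 0 ≤ z l}, ∀ w ∈ {z : O → ℝ | ∀ l, 0 ≤ z l},
      (∀ l, w l ≤ z l) → w ≠ z → u i w < u i z)
    (ω : I → O → ℝ) (hωX : ∀ i, ω i ∈ X i) (hω𝒞 : ω ∈ 𝒞)
    (hωc : ∀ c, 0 < dotIO (a c) ω)
    (ε : ℝ) (hε : 0 < ε) :
    ∃ (α : ℝ) (x : I → O → ℝ) (p : C → ℝ),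
      0 < α ∧ α ≤ 1 ∧
      (∀ c, 0 ≤ p c) ∧
      (∀ i, x i ∈ X i ∧
        dotO (pers a p i) (x i) ≤ α + (1 - α) * dotO (pers a p i) (ω i) ∧
        ∀ z ∈ X i, dotO (pers a p i) z ≤ α + (1 - α) * dotO (pers a p i) (ω i) →
          u i z ≤ u i (x i)) ∧
      x ∈ 𝒞 ∧
      (∀ c, dotIO (a c) x < b c → p c = 0) ∧
      (¬ ∃ y ∈ 𝒞, (∀ i, u i (x i) ≤ u i (y i)) ∧ ∃ j, u j (x j) < u j (y j)) ∧
      (∀ i, ∀ y ∈ X i, dotO (pers a p i) y ≤ dotO (pers a p i) (ω i) →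
        u i y - u i (x i) < ε) ∧
      (∀ i, u i (ω i) - ε < u i (x i)) := by
  have hXsub : ∀ i, X i ⊆ {z : O → ℝ | ∀ l, 0 ≤ z l} := fun i z hz => hXnn i z hz
  have hfeas : ∀ y ∈ 𝒞, (∀ i, y i ∈ X i) ∧ ∀ c, dotIO (a c) y ≤ b c := fun y hy =>
    (hlcs.subset ⟨h𝒞nn y hy, y, hy, fun _ _ => le_rfl⟩).2
  have hωb := (hfeas ω hω𝒞).2
  obtain ⟨α, hαε, hα0, hα1⟩ := ((Filter.eventually_all.2 fun i =>
    eventually_forall_sub_smul_lt (hXcpt i) (hXcvx i) (hX0 i) ((hu_cont i).mono (hXsub i)) hε).and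
      (Ioo_mem_nhdsGT (zero_lt_one (α := ℝ)))).exists
  obtain ⟨p, x, hp, hx, hclear, hcs⟩ := exists_slack_market_clearing X hXcpt hXcvx hX0 hXnn a b
    ha hb u (fun i => (hu_cont i).mono (hXsub i))
    (fun i z hz y hy => hu_qc i z (hXsub i hz) y (hXsub i hy))
    (fun i z hz y hy => hu_ssqc i z (hXsub i hz) y (hXsub i hy)) ω hωX hωb hα0 hα1.le
  have hvalue : ∀ y ∈ 𝒞, ∑ i, dotO (pers a p i) (y i) ≤ ∑ i, dotO (pers a p i) (x i) := by
    intro y hy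
    rw [sum_dotO_pers, sum_dotO_pers]
    refine sum_le_sum fun c _ => ?_
    rcases (hclear c).lt_or_eq with h | h
    · simp [hcs c h]
    · rw [h]
      exact mul_le_mul_of_nonneg_left ((hfeas y hy).2 c) (hp c)
  have hdearer : ∀ i, ∀ y ∈ X i, u i (x i) < u i y →
      dotO (pers a p i) (x i) < dotO (pers a p i) y := by
    intro i y hy hlt
    by_contra! hle
    exact ((hx i).2.2.1 y hy (hle.trans (hx i).2.1)).not_gt hlt
  have hnocheaper : ∀ i, ∀ y ∈ X i, u i (x i) ≤ u i y →
      dotO (pers a p i) (x i) ≤ dotO (pers a p i) y := by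
    intro i y hy hle
    by_contra! hlt
    exact ((hx i).2.2.2 y hy (hlt.le.trans (hx i).2.1) hle).not_gt hlt
  have heff : ¬ ∃ y ∈ 𝒞, (∀ i, u i (x i) ≤ u i (y i)) ∧ ∃ j, u j (x j) < u j (y j) := by
    rintro ⟨y, hy, hle, j, hj⟩
    exact (hvalue y hy).not_gt (sum_lt_sum
      (fun i _ => hnocheaper i _ ((hfeas y hy).1 i) (hle i))
      ⟨j, mem_univ j, hdearer j _ ((hfeas y hy).1 j) hj⟩)
  have hxnn : ∀ i l, 0 ≤ x i l := fun i => hXnn i _ (hx i).1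
  have hx𝒞 : x ∈ 𝒞 := by
    obtain ⟨-, y, hy, hxy⟩ := hlcs.superset ⟨hxnn, fun i => (hx i).1, hclear⟩
    suffices x = y by rwa [this]
    by_contra hne
    obtain ⟨j, hj⟩ := Function.ne_iff.1 hne
    have hlt := fun i => hu_mono i (y i) (h𝒞nn y hy i) (x i) (hxnn i) (hxy i)
    refine heff ⟨y, hy, fun i => ?_, j, hlt j hj⟩
    by_cases h : x i = y i
    · rw [h]
    · exact (hlt i h).le
  have hir : ∀ i, ∀ y ∈ X i, dotO (pers a p i) y ≤ dotO (pers a p i) (ω i) →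
      u i y - u i (x i) < ε := by
    intro i y hy hyω
    have hmem : (1 - α) • y ∈ X i :=
      (hXcvx i).smul_mem_of_zero_mem (hX0 i) hy ⟨by linarith, by linarith⟩
    have hle := (hx i).2.2.1 _ hmem (by
      rw [dotO_smul]
      have := mul_le_mul_of_nonneg_left hyω (sub_nonneg.2 hα1.le)
      linarith)
    linarith [hαε i y hy]
  exact ⟨α, x, p, hα0, hα1.le, hp, fun i => ⟨(hx i).1, (hx i).2.1, (hx i).2.2.1⟩, hx𝒞, hcs, heff,
    hir, fun i => by linarith [hir i (ω i) (hωX i) le_rfl]⟩
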